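/- arXiv:1608.06644 — 2 statements merged into one kernel-verified Lean document; each statement's English description precedes it below -/
import Mathlib

section
/- Let U be a nonempty, simply connected, open subset of the complex plane ℂ with U ≠ ℂ. Then U is biholomorphic to the open unit disk 𝔻 = {z ∈ ℂ : |z| < 1}; that is, there exists a bijection f : U → 𝔻 such that f is holomorphic on U and its inverse is holomorphic on 𝔻. (Riemann mapping theorem, the starting point of the uniformisation theorem, Theorem 1.1.) -/
open Metric Set Filter Topology ComplexConjugate

namespace RiemannMapping

/-! ### Injective holomorphic functions -/

section Injective

variable {U : Set ℂ} {f : ℂ → ℂ} {a : ℂ}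

theorem frequently_ne_of_injOn (hU : IsOpen U) (hinj : InjOn f U) (ha : a ∈ U) :
    ∃ᶠ z in 𝓝 a, f z ≠ f a := by
  have h : ∀ᶠ z in 𝓝[≠] a, f z ≠ f a := by
    filter_upwards [self_mem_nhdsWithin, mem_nhdsWithin_of_mem_nhds (hU.mem_nhds ha)] with z hz hzU
    exact fun h ↦ hz (hinj hzU ha h)
  exact h.frequently.filter_mono nhdsWithin_le_nhds

theorem nhds_le_map_nhds_of_injOn (hU : IsOpen U) (hf : DifferentiableOn ℂ f U)
    (hinj : InjOn f U) (ha : a ∈ U) : 𝓝 (f a) ≤ map f (𝓝 a) :=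
  (hf.analyticAt (hU.mem_nhds ha)).eventually_constant_or_nhds_le_map_nhds.resolve_left
    (by simpa using frequently_ne_of_injOn hU hinj ha)

theorem isOpen_image_of_injOn (hU : IsOpen U) (hf : DifferentiableOn ℂ f U)
    (hinj : InjOn f U) : IsOpen (f '' U) := by
  rw [isOpen_iff_mem_nhds]
  rintro _ ⟨a, ha, rfl⟩
  exact nhds_le_map_nhds_of_injOn hU hf hinj ha (image_mem_map (hU.mem_nhds ha))

theorem eventually_deriv_ne_zero_of_injOn (hU : IsOpen U) (hf : DifferentiableOn ℂ f U)
    (hinj : InjOn f U) (ha : a ∈ U) : ∀ᶠ z in 𝓝[≠] a, deriv f z ≠ 0 := by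
  refine (hf.analyticAt (hU.mem_nhds ha)).deriv.eventually_eq_zero_or_eventually_ne_zero.resolve_left
    fun h ↦ frequently_ne_of_injOn hU hinj ha ?_
  obtain ⟨r, hr, hrU⟩ := Metric.mem_nhds_iff.1 (inter_mem h (hU.mem_nhds ha))
  filter_upwards [ball_mem_nhds a hr] with z hz
  rw [not_not]
  exact isOpen_ball.is_const_of_deriv_eq_zero (convex_ball a r).isPreconnected
    (hf.mono fun w hw ↦ (hrU hw).2) (fun w hw ↦ (hrU hw).1) hz (mem_ball_self hr)

/-- A left inverse of an injective holomorphic function is holomorphic on its image. -/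
theorem differentiableOn_leftInverse_of_injOn {g : ℂ → ℂ} (hU : IsOpen U)
    (hf : DifferentiableOn ℂ f U) (hinj : InjOn f U) (hg : ∀ z ∈ U, g (f z) = z) :
    DifferentiableOn ℂ g (f '' U) := by
  have hopen : IsOpen (f '' U) := isOpen_image_of_injOn hU hf hinj
  have hcont : ∀ w ∈ f '' U, ContinuousAt g w := by
    rintro _ ⟨a, ha, rfl⟩
    rw [ContinuousAt, hg a ha]
    refine Tendsto.mono_left ?_ (nhds_le_map_nhds_of_injOn hU hf hinj ha)
    rw [tendsto_map'_iff]
    exact tendsto_id.congr' (by filter_upwards [hU.mem_nhds ha] with z hz using (hg z hz).symm)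
  rintro _ ⟨a, ha, rfl⟩
  refine (Complex.analyticAt_of_differentiable_on_punctured_nhds_of_continuousAt ?_
    (hcont _ (mem_image_of_mem f ha))).differentiableAt.differentiableWithinAt
  have hev := eventually_nhdsWithin_iff.1 (eventually_deriv_ne_zero_of_injOn hU hf hinj ha)
  have hga : Tendsto g (𝓝 (f a)) (𝓝 a) := by
    simpa [ContinuousAt, hg a ha] using hcont _ (mem_image_of_mem f ha)
  rw [eventually_nhdsWithin_iff]
  filter_upwards [hga.eventually hev, hopen.mem_nhds (mem_image_of_mem f ha)] with w hw hwU hwa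
  obtain ⟨z, hz, rfl⟩ := hwU
  rw [hg z hz] at hw
  have hza : z ∈ ({a}ᶜ : Set ℂ) := fun h ↦ hwa (congrArg f h)
  refine (HasDerivAt.of_local_left_inverse (f := f) (hcont _ (mem_image_of_mem f hz)) ?_ (hw hza)
    ?_).differentiableAt
  · rw [hg z hz]
    exact (hf.differentiableAt (hU.mem_nhds hz)).hasDerivAt
  · filter_upwards [hopen.mem_nhds (mem_image_of_mem f hz)]
    rintro _ ⟨y, hy, rfl⟩
    rw [hg y hy]

end Injective

/-! ### Limits of holomorphic functions -/

section Limits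

variable {ι : Type*} {U : Set ℂ} {F : ι → ℂ → ℂ} {f : ℂ → ℂ} {l : Filter ι}

/-- Pointwise convergence of holomorphic functions with values in the closed unit disk
is locally uniform. -/
theorem tendstoLocallyUniformlyOn_of_tendsto [l.NeBot] (hU : IsOpen U)
    (hF : ∀ i, DifferentiableOn ℂ (F i) U) (hmaps : ∀ i, MapsTo (F i) U (closedBall 0 1))
    (hlim : ∀ z ∈ U, Tendsto (fun i ↦ F i z) l (𝓝 (f z))) :
    TendstoLocallyUniformlyOn F f l U := by
  rw [Metric.tendstoLocallyUniformlyOn_iff]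
  intro ε hε z hz
  obtain ⟨r, hr, hrU⟩ := Metric.isOpen_iff.1 hU z hz
  have hlip : ∀ i, ∀ y ∈ ball z r, dist (F i y) (F i z) ≤ 2 / r * dist y z := fun i y hy ↦
    Complex.dist_le_div_mul_dist_of_mapsTo_ball ((hF i).mono hrU) (fun x hx ↦ by
      have h1 := hmaps i (hrU hx)
      have h2 := hmaps i hz
      rw [mem_closedBall] at *
      linarith [dist_triangle_right (F i x) (F i z) 0]) hy
  have hlip' : ∀ y ∈ ball z r, dist (f y) (f z) ≤ 2 / r * dist y z := fun y hy ↦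
    le_of_tendsto ((hlim y (hrU hy)).dist (hlim z hz)) (.of_forall fun i ↦ hlip i y hy)
  have hsmall : ∀ᶠ y in 𝓝 z, 2 / r * dist y z < ε / 4 := by
    have : Tendsto (fun y ↦ 2 / r * dist y z) (𝓝 z) (𝓝 (2 / r * dist z z)) := by
      apply Continuous.tendsto; fun_prop
    exact this.eventually_lt_const (by simpa using by positivity)
  refine ⟨{y | 2 / r * dist y z < ε / 4} ∩ ball z r,
    mem_nhdsWithin_of_mem_nhds (inter_mem hsmall (ball_mem_nhds z hr)), ?_⟩
  filter_upwards [Metric.tendsto_nhds.1 (hlim z hz) (ε / 4) (by positivity)] with i hi y hy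
  have h1 := hlip i y hy.2
  have h2 := hlip' y hy.2
  have h3 : 2 / r * dist y z < ε / 4 := hy.1
  have h4 := dist_triangle4 (f y) (f z) (F i z) (F i y)
  rw [dist_comm (f z), dist_comm (F i z) (F i y)] at h4
  linarith

/-- **Hurwitz's theorem**: a locally uniform limit of injective holomorphic functions on a
connected open set is injective, provided that its derivative does not vanish identically. -/
theorem injOn_of_tendstoLocallyUniformlyOn [l.NeBot] (hU : IsOpen U) (hUc : IsPreconnected U)
    (hF : ∀ i, DifferentiableOn ℂ (F i) U) (hinj : ∀ i, InjOn (F i) U)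
    (hlim : TendstoLocallyUniformlyOn F f l U) {z₀ : ℂ} (hz₀ : z₀ ∈ U) (hd : deriv f z₀ ≠ 0) :
    InjOn f U := by
  have hf : DifferentiableOn ℂ f U := hlim.differentiableOn (.of_forall hF) hU
  intro a ha b hb hab
  by_contra hne
  have hiso : ∀ᶠ z in 𝓝[≠] a, f z ≠ f a := by
    refine ((hf.analyticAt (hU.mem_nhds ha)).eventually_eq_or_eventually_ne
      analyticAt_const).resolve_left fun h ↦ hd ?_
    have heq := (hf.analyticOnNhd hU).eqOn_of_preconnected_of_eventuallyEq
      analyticOnNhd_const hUc ha h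
    rw [(heq.eventuallyEq_of_mem (hU.mem_nhds hz₀)).deriv_eq, deriv_const]
  obtain ⟨R, hR, hRs⟩ := Metric.mem_nhds_iff.1
    (inter_mem (eventually_nhdsWithin_iff.1 hiso) (hU.mem_nhds ha))
  obtain ⟨r, hr, hrR⟩ : ∃ r, 0 < r ∧ r < min R (dist a b) :=
    exists_between (lt_min hR (dist_pos.2 hne))
  have hball : closedBall a r ⊆ U := fun z hz ↦
    (hRs (closedBall_subset_ball (hrR.trans_le (min_le_left _ _)) hz)).2
  have hsub : sphere a r ⊆ U := sphere_subset_closedBall.trans hball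
  obtain ⟨x, hx, hmin⟩ := (isCompact_sphere a r).exists_isMinOn
    (NormedSpace.sphere_nonempty.2 hr.le)
    ((hf.continuousOn.mono hsub).sub continuousOn_const |>.norm :
      ContinuousOn (fun z ↦ ‖f z - f a‖) (sphere a r))
  set ε := ‖f x - f a‖ with hε
  have hεpos : 0 < ε := by
    rw [hε, norm_pos_iff, sub_ne_zero]
    exact (hRs (closedBall_subset_ball (hrR.trans_le (min_le_left _ _))
      (sphere_subset_closedBall hx))).1 (ne_of_mem_sphere hx hr.ne')
  have hunif := (tendstoLocallyUniformlyOn_iff_forall_isCompact hU).1 hlim _ hball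
    (isCompact_closedBall a r)
  obtain ⟨i, hi, hib⟩ := ((Metric.tendstoUniformlyOn_iff.1 hunif (ε / 8) (by positivity)).and
    (Metric.tendsto_nhds.1 (hlim.tendsto_at hb) (ε / 8) (by positivity))).exists
  have hia := hi a (mem_closedBall_self hr.le)
  have hsphere : ∀ z ∈ sphere a r, ε / 2 ≤ ‖F i z - F i a‖ := by
    intro z hz
    have h1 : ε ≤ ‖f z - f a‖ := hmin hz
    have h2 := hi z (sphere_subset_closedBall hz)
    rw [← dist_eq_norm] at h1 ⊢
    have h3 := dist_triangle4 (f z) (F i z) (F i a) (f a)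
    rw [dist_comm (F i a) (f a)] at h3
    linarith
  have himage := DiffContOnCl.ball_subset_image_closedBall
    (((hF i).mono hball).diffContOnCl_ball subset_rfl) hr hsphere
    (frequently_ne_of_injOn hU (hinj i) ha)
  have hmem : F i b ∈ ball (F i a) (ε / 2 / 2) := by
    rw [mem_ball]
    have h3 := dist_triangle (F i b) (f a) (F i a)
    rw [← hab] at hib
    linarith
  obtain ⟨w, hw, hwb⟩ := himage hmem
  have : w = b := hinj i (hball hw) hb hwb
  rw [this, mem_closedBall, dist_comm] at hw
  exact absurd hw (not_le.2 (hrR.trans_le (min_le_right _ _)))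

end Limits

/-! ### Disk automorphisms and square roots -/

/-- The automorphism of the unit disk which sends `a` to `0`. -/
noncomputable def diskShift (a z : ℂ) : ℂ := (z - a) / (1 - conj a * z)

section DiskShift

variable {a z : ℂ}

theorem one_sub_conj_mul_ne_zero (ha : ‖a‖ < 1) (hz : ‖z‖ ≤ 1) : 1 - conj a * z ≠ 0 := by
  intro h
  have h1 : ‖conj a * z‖ = 1 := by rw [← sub_eq_zero.1 h, norm_one]
  rw [norm_mul, RCLike.norm_conj] at h1
  nlinarith [norm_nonneg a, norm_nonneg z]

theorem diskShift_self : diskShift a a = 0 := by simp [diskShift]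

theorem norm_diskShift_lt_one (ha : ‖a‖ < 1) (hz : ‖z‖ < 1) : ‖diskShift a z‖ < 1 := by
  rw [diskShift, norm_div, div_lt_one (norm_pos_iff.2 (one_sub_conj_mul_ne_zero ha hz.le))]
  refine lt_of_pow_lt_pow_left₀ 2 (norm_nonneg _) ?_
  have key : Complex.normSq (1 - conj a * z) - Complex.normSq (z - a)
      = (1 - Complex.normSq a) * (1 - Complex.normSq z) := by
    simp only [Complex.normSq_apply, Complex.sub_re, Complex.sub_im, Complex.mul_re,
      Complex.mul_im, Complex.conj_re, Complex.conj_im, Complex.one_re, Complex.one_im]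
    ring
  simp only [Complex.normSq_eq_norm_sq] at key
  have h1 : ‖a‖ ^ 2 < 1 := pow_lt_one₀ (norm_nonneg a) ha two_ne_zero
  have h2 : ‖z‖ ^ 2 < 1 := pow_lt_one₀ (norm_nonneg z) hz two_ne_zero
  nlinarith [mul_pos (sub_pos.2 h1) (sub_pos.2 h2)]

theorem injOn_diskShift (ha : ‖a‖ < 1) : InjOn (diskShift a) (ball 0 1) := by
  intro z hz w hw h
  rw [mem_ball_zero_iff] at hz hw
  rw [diskShift, diskShift, div_eq_div_iff (one_sub_conj_mul_ne_zero ha hz.le)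
    (one_sub_conj_mul_ne_zero ha hw.le)] at h
  have : (z - w) * (1 - conj a * a) = 0 := by linear_combination h
  exact sub_eq_zero.1 ((mul_eq_zero.1 this).resolve_right (one_sub_conj_mul_ne_zero ha ha.le))

theorem hasDerivAt_diskShift (ha : ‖a‖ < 1) (hz : ‖z‖ < 1) :
    HasDerivAt (diskShift a) ((1 - conj a * a) / (1 - conj a * z) ^ 2) z := by
  have h := ((hasDerivAt_id z).sub_const a).div (((hasDerivAt_id z).const_mul (conj a)).const_sub 1)
    (one_sub_conj_mul_ne_zero ha hz.le)
  refine h.congr_deriv ?_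
  simp only [id]
  congr 1
  ring

theorem differentiableOn_diskShift (ha : ‖a‖ < 1) :
    DifferentiableOn ℂ (diskShift a) (ball 0 1) := fun _ hz ↦
  (hasDerivAt_diskShift ha (mem_ball_zero_iff.1 hz)).differentiableAt.differentiableWithinAt

theorem mapsTo_diskShift (ha : ‖a‖ < 1) : MapsTo (diskShift a) (ball 0 1) (ball 0 1) :=
  fun _ hz ↦ mem_ball_zero_iff.2 (norm_diskShift_lt_one ha (mem_ball_zero_iff.1 hz))

end DiskShift

theorem hasDerivAt_of_sq_eq {s g : ℂ → ℂ} {g' z : ℂ} (hs : ContinuousAt s z)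
    (hsq : ∀ w, s w ^ 2 = g w) (hg : HasDerivAt g g' z) (hz : s z ≠ 0) :
    HasDerivAt s (g' / (2 * s z)) z := by
  rw [hasDerivAt_iff_tendsto_slope] at hg ⊢
  have hsum : Tendsto (fun w ↦ s w + s z) (𝓝[≠] z) (𝓝 (2 * s z)) := by
    rw [two_mul]
    exact (hs.tendsto.mono_left nhdsWithin_le_nhds).add_const _
  have h0 : 2 * s z ≠ 0 := mul_ne_zero two_ne_zero hz
  refine (hg.div hsum h0).congr' ?_
  filter_upwards [hsum.eventually_ne h0] with w hw
  rw [Pi.div_apply, slope_def_field, slope_def_field, div_eq_iff hw, ← hsq, ← hsq]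
  ring

/-! ### The extremal problem -/

/-- Injective holomorphic functions from `U` to the closed unit disk which vanish at `z₀`. -/
structure IsCandidate (U : Set ℂ) (z₀ : ℂ) (f : ℂ → ℂ) : Prop where
  differentiableOn : DifferentiableOn ℂ f U
  mapsTo_closedBall : MapsTo f U (closedBall 0 1)
  injOn : InjOn f U
  map_eq_zero : f z₀ = 0

section Candidates

variable {U : Set ℂ} {z₀ : ℂ} {f : ℂ → ℂ}

theorem IsCandidate.mapsTo_ball (hU : IsOpen U) (hf : IsCandidate U z₀ f) :
    MapsTo f U (ball 0 1) := by
  have h := interior_maximal hf.mapsTo_closedBall.image_subset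
    (isOpen_image_of_injOn hU hf.differentiableOn hf.injOn)
  rw [interior_closedBall _ one_ne_zero] at h
  exact mapsTo_iff_image_subset.2 h

/-- Moving the value at `z₀` of an injective map to the disk to the origin. -/
theorem isCandidate_diskShift_comp (hz₀ : z₀ ∈ U) (hf : DifferentiableOn ℂ f U)
    (hmaps : MapsTo f U (ball 0 1)) (hinj : InjOn f U) :
    IsCandidate U z₀ (diskShift (f z₀) ∘ f) := by
  have h0 : ‖f z₀‖ < 1 := mem_ball_zero_iff.1 (hmaps hz₀)
  exact ⟨(differentiableOn_diskShift h0).comp hf hmaps,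
    ((mapsTo_diskShift h0).comp hmaps).mono_right ball_subset_closedBall,
    (injOn_diskShift h0).comp hinj hmaps, diskShift_self⟩

theorem hasDerivAt_diskShift_comp {f' : ℂ} (h0 : ‖f z₀‖ < 1) (hf : HasDerivAt f f' z₀) :
    HasDerivAt (diskShift (f z₀) ∘ f) (f' / (1 - conj (f z₀) * f z₀)) z₀ := by
  refine ((hasDerivAt_diskShift h0 h0).comp z₀ hf).congr_deriv ?_
  have := one_sub_conj_mul_ne_zero h0 h0.le
  field_simp

/-- A proper simply connected open set admits an injective holomorphic map to the unit disk,
obtained from a branch of `√(z - a)` with `a ∉ U`. -/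
theorem exists_injOn_mapsTo_ball_deriv_ne_zero (hU : IsOpen U) (hUc : IsSimplyConnected U)
    (hne : U ≠ univ) (hz₀ : z₀ ∈ U) : ∃ f : ℂ → ℂ, DifferentiableOn ℂ f U ∧ MapsTo f U (ball 0 1) ∧
      InjOn f U ∧ deriv f z₀ ≠ 0 := by
  obtain ⟨a, ha⟩ := (ne_univ_iff_exists_notMem U).1 hne
  have hane : ∀ z ∈ U, z - a ≠ 0 := fun z hz ↦ sub_ne_zero.2 (ne_of_mem_of_not_mem hz ha)
  obtain ⟨s, hsc, hsq⟩ := Complex.exists_continuousOn_pow_eq hUc hU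
    (g := fun z ↦ z - a) (by fun_prop) (by rintro ⟨z, hz, h⟩; exact hane z hz h) two_ne_zero
  have hs0 : ∀ z ∈ U, s z ≠ 0 := fun z hz h ↦
    hane z hz (by rw [← hsq, h, zero_pow two_ne_zero])
  have hsd : ∀ z ∈ U, HasDerivAt s (1 / (2 * s z)) z := fun z hz ↦
    hasDerivAt_of_sq_eq (hsc.continuousAt (hU.mem_nhds hz)) hsq
      ((hasDerivAt_id z).sub_const a) (hs0 z hz)
  have hsinj : InjOn s U := fun x _ y _ h ↦ by
    have h2 : x - a = y - a := by rw [← hsq, ← hsq, h]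
    exact sub_left_injective h2
  obtain ⟨ε, hε, hball⟩ := Metric.isOpen_iff.1 (isOpen_image_of_injOn hU
    (fun z hz ↦ (hsd z hz).differentiableAt.differentiableWithinAt) hsinj) _
    (mem_image_of_mem s hz₀)
  have hfar : ∀ z ∈ U, ε ≤ ‖s z + s z₀‖ := by
    intro z hz
    by_contra! hlt
    have hmem : -s z ∈ ball (s z₀) ε := by
      rwa [mem_ball, dist_eq_norm, ← norm_neg, neg_sub, sub_neg_eq_add, add_comm]
    obtain ⟨y, hy, hyz⟩ := hball hmem
    have h2 : y - a = z - a := by rw [← hsq, ← hsq, hyz, neg_sq]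
    rw [sub_left_injective h2] at hyz
    exact hs0 z hz (self_eq_neg.1 hyz)
  have hne0 : ∀ z ∈ U, s z + s z₀ ≠ 0 := fun z hz ↦ norm_pos_iff.1 (hε.trans_le (hfar z hz))
  have hε0 : ((ε / 2 : ℝ) : ℂ) ≠ 0 := Complex.ofReal_ne_zero.2 (by positivity)
  have hd : ∀ z ∈ U, HasDerivAt (fun z ↦ ((ε / 2 : ℝ) : ℂ) * (s z + s z₀)⁻¹)
      (((ε / 2 : ℝ) : ℂ) * (-(1 / (2 * s z)) / (s z + s z₀) ^ 2)) z := fun z hz ↦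
    (((hsd z hz).add_const (s z₀)).fun_inv (hne0 z hz)).const_mul _
  refine ⟨_, fun z hz ↦ (hd z hz).differentiableAt.differentiableWithinAt, ?_, ?_, ?_⟩
  · intro z hz
    have h := hfar z hz
    rw [mem_ball_zero_iff, norm_mul, norm_inv, Complex.norm_real,
      Real.norm_of_nonneg (by positivity), ← div_eq_mul_inv, div_lt_one (hε.trans_le h)]
    linarith
  · intro x hx y hy h
    exact hsinj hx hy (add_right_cancel (inv_injective (mul_left_cancel₀ hε0 h)))
  · rw [(hd z₀ hz₀).deriv]
    exact mul_ne_zero hε0 (div_ne_zero (neg_ne_zero.2 (one_div_ne_zero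
      (mul_ne_zero two_ne_zero (hs0 z₀ hz₀)))) (pow_ne_zero 2 (hne0 z₀ hz₀)))

theorem exists_isCandidate_deriv_ne_zero (hU : IsOpen U) (hUc : IsSimplyConnected U)
    (hne : U ≠ univ) (hz₀ : z₀ ∈ U) : ∃ f, IsCandidate U z₀ f ∧ deriv f z₀ ≠ 0 := by
  obtain ⟨f, hf, hmaps, hinj, hd⟩ := exists_injOn_mapsTo_ball_deriv_ne_zero hU hUc hne hz₀
  have h0 : ‖f z₀‖ < 1 := mem_ball_zero_iff.1 (hmaps hz₀)
  refine ⟨_, isCandidate_diskShift_comp hz₀ hf hmaps hinj, ?_⟩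
  rw [(hasDerivAt_diskShift_comp h0 (hf.differentiableAt (hU.mem_nhds hz₀)).hasDerivAt).deriv]
  exact div_ne_zero hd (one_sub_conj_mul_ne_zero h0 h0.le)

/-- There is a candidate whose derivative at `z₀` has the largest absolute value. -/
theorem exists_isCandidate_maximal (hU : IsOpen U) (hUc : IsSimplyConnected U)
    (hne : U ≠ univ) (hz₀ : z₀ ∈ U) : ∃ f, IsCandidate U z₀ f ∧ deriv f z₀ ≠ 0 ∧
      ∀ g, IsCandidate U z₀ g → ‖deriv g z₀‖ ≤ ‖deriv f z₀‖ := by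
  obtain ⟨f₁, hf₁, hd₁⟩ := exists_isCandidate_deriv_ne_zero hU hUc hne hz₀
  set S : Set ℝ := (fun g ↦ ‖deriv g z₀‖) '' {g | IsCandidate U z₀ g} with hS
  have hSne : S.Nonempty := ⟨_, f₁, hf₁, rfl⟩
  obtain ⟨r, hr, hrU⟩ := Metric.isOpen_iff.1 hU z₀ hz₀
  have hSbdd : BddAbove S := by
    refine ⟨1 / r, ?_⟩
    rintro _ ⟨g, hg, rfl⟩
    refine Complex.norm_deriv_le_div_of_mapsTo_ball (hg.differentiableOn.mono hrU) ?_ hr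
    rw [hg.map_eq_zero]
    exact hg.mapsTo_closedBall.mono_left hrU
  obtain ⟨u, -, hulim, huS⟩ := exists_seq_tendsto_sSup hSne hSbdd
  choose F hF hFu using huS
  let l : Ultrafilter ℕ := hyperfilter ℕ
  have hl : (l : Filter ℕ) ≤ atTop := Nat.hyperfilter_le_atTop
  have hptwise : ∀ z, ∃ w, z ∈ U → Tendsto (fun n ↦ F n z) l (𝓝 w) ∧ w ∈ closedBall (0 : ℂ) 1 := by
    intro z
    by_cases hz : z ∈ U
    · obtain ⟨w, hw, hlw⟩ := (isCompact_closedBall (0 : ℂ) 1).ultrafilter_le_nhds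
        (l.map fun n ↦ F n z) (by
          rw [le_principal_iff]
          exact Filter.mem_map.2 (univ_mem' fun n ↦ (hF n).mapsTo_closedBall hz))
      exact ⟨w, fun _ ↦ ⟨hlw, hw⟩⟩
    · exact ⟨0, fun h ↦ absurd h hz⟩
  choose f hf using hptwise
  have hlim : TendstoLocallyUniformlyOn F f l U := tendstoLocallyUniformlyOn_of_tendsto hU
    (fun n ↦ (hF n).differentiableOn) (fun n ↦ (hF n).mapsTo_closedBall) fun z hz ↦ (hf z hz).1
  have hFd : ∀ᶠ n in (l : Filter ℕ), DifferentiableOn ℂ (F n) U :=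
    .of_forall fun n ↦ (hF n).differentiableOn
  have hderiv : ‖deriv f z₀‖ = sSup S := by
    refine tendsto_nhds_unique ((hlim.deriv hFd hU).tendsto_at hz₀).norm ?_
    exact (hulim.mono_left hl).congr fun n ↦ (hFu n).symm
  have hmax : ∀ g, IsCandidate U z₀ g → ‖deriv g z₀‖ ≤ ‖deriv f z₀‖ := fun g hg ↦ by
    rw [hderiv]
    exact le_csSup hSbdd ⟨g, hg, rfl⟩
  have hd : deriv f z₀ ≠ 0 := norm_pos_iff.1 ((norm_pos_iff.2 hd₁).trans_le (hmax f₁ hf₁))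
  refine ⟨f, ⟨hlim.differentiableOn hFd hU, fun z hz ↦ (hf z hz).2, ?_, ?_⟩, hd, hmax⟩
  · exact injOn_of_tendstoLocallyUniformlyOn hU hUc.isPathConnected.isConnected.isPreconnected
      (fun n ↦ (hF n).differentiableOn) (fun n ↦ (hF n).injOn) hlim hz₀ hd
  · exact tendsto_nhds_unique (hf z₀ hz₀).1
      (tendsto_const_nhds.congr fun n ↦ (hF n).map_eq_zero.symm)

/-- If a candidate omits a value in the disk, then there is a candidate with a larger derivative. -/
theorem IsCandidate.exists_norm_deriv_lt (hU : IsOpen U) (hUc : IsSimplyConnected U)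
    (hz₀ : z₀ ∈ U) (hf : IsCandidate U z₀ f) (hd : deriv f z₀ ≠ 0) {w : ℂ}
    (hw : w ∈ ball (0 : ℂ) 1) (hwf : w ∉ f '' U) :
    ∃ g, IsCandidate U z₀ g ∧ ‖deriv f z₀‖ < ‖deriv g z₀‖ := by
  rw [mem_ball_zero_iff] at hw
  have hmaps := hf.mapsTo_ball hU
  set p : ℂ → ℂ := diskShift w ∘ f with hp
  have hpmaps : MapsTo p U (ball 0 1) := (mapsTo_diskShift hw).comp hmaps
  have hpd : DifferentiableOn ℂ p U :=
    (differentiableOn_diskShift hw).comp hf.differentiableOn hmaps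
  have hpinj : InjOn p U := (injOn_diskShift hw).comp hf.injOn hmaps
  have hp0 : ∀ z ∈ U, p z ≠ 0 := by
    intro z hz h
    have : w = f z := injOn_diskShift hw (mem_ball_zero_iff.2 hw) (hmaps hz)
      (diskShift_self.trans h.symm)
    exact hwf ⟨z, hz, this.symm⟩
  obtain ⟨s, hsc, hsq⟩ := Complex.exists_continuousOn_pow_eq hUc hU hpd.continuousOn
    (by rintro ⟨z, hz, h⟩; exact hp0 z hz h) two_ne_zero
  have hs0 : ∀ z ∈ U, s z ≠ 0 := fun z hz h ↦ hp0 z hz (by rw [← hsq, h, zero_pow two_ne_zero])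
  have hsd : ∀ z ∈ U, HasDerivAt s (deriv p z / (2 * s z)) z := fun z hz ↦
    hasDerivAt_of_sq_eq (hsc.continuousAt (hU.mem_nhds hz)) hsq
      (hpd.differentiableAt (hU.mem_nhds hz)).hasDerivAt (hs0 z hz)
  have hsmaps : MapsTo s U (ball 0 1) := fun z hz ↦ by
    have h := hpmaps hz
    rw [mem_ball_zero_iff, ← hsq, norm_pow] at h
    exact mem_ball_zero_iff.2 ((pow_lt_one_iff_of_nonneg (norm_nonneg _) two_ne_zero).1 h)
  have hsinj : InjOn s U := fun x hx y hy h ↦ hpinj hx hy (by rw [← hsq, ← hsq, h])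
  have hb : ‖s z₀‖ < 1 := mem_ball_zero_iff.1 (hsmaps hz₀)
  refine ⟨_, isCandidate_diskShift_comp hz₀
    (fun z hz ↦ (hsd z hz).differentiableAt.differentiableWithinAt) hsmaps hsinj, ?_⟩
  have hpderiv : deriv p z₀ = (1 - conj w * w) * deriv f z₀ := by
    have h := hasDerivAt_diskShift hw (mem_ball_zero_iff.1 (hmaps hz₀))
    rw [(h.comp z₀ (hf.differentiableOn.differentiableAt (hU.mem_nhds hz₀)).hasDerivAt).deriv,
      hf.map_eq_zero]
    simp
  have hwb : ‖w‖ = ‖s z₀‖ ^ 2 := by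
    rw [← norm_pow, hsq, hp, Function.comp_apply, hf.map_eq_zero]
    simp [diskShift]
  have hconj : ∀ c : ℂ, ‖c‖ < 1 → ‖1 - conj c * c‖ = 1 - ‖c‖ ^ 2 := by
    intro c hc
    rw [Complex.conj_mul', ← Complex.ofReal_pow, ← Complex.ofReal_one, ← Complex.ofReal_sub,
      Complex.norm_real, Real.norm_of_nonneg]
    exact sub_nonneg.2 (pow_le_one₀ (norm_nonneg c) hc.le)
  rw [(hasDerivAt_diskShift_comp hb (hsd z₀ hz₀)).deriv, hpderiv, norm_div, norm_div, norm_mul,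
    norm_mul, hconj w hw, hconj _ hb, hwb, Complex.norm_ofNat]
  have hbpos : 0 < ‖s z₀‖ := norm_pos_iff.2 (hs0 z₀ hz₀)
  have hdpos : 0 < ‖deriv f z₀‖ := norm_pos_iff.2 hd
  have h1 : 0 < 1 - ‖s z₀‖ ^ 2 := sub_pos.2 (pow_lt_one₀ hbpos.le hb two_ne_zero)
  rw [div_div, lt_div_iff₀ (by positivity)]
  have h2 : 0 < ‖deriv f z₀‖ * (1 - ‖s z₀‖ ^ 2) * (1 - ‖s z₀‖) ^ 2 :=
    mul_pos (mul_pos hdpos h1) (pow_pos (sub_pos.2 hb) 2)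
  linarith [show (1 - (‖s z₀‖ ^ 2) ^ 2) * ‖deriv f z₀‖
    - ‖deriv f z₀‖ * (2 * ‖s z₀‖ * (1 - ‖s z₀‖ ^ 2))
    = ‖deriv f z₀‖ * (1 - ‖s z₀‖ ^ 2) * (1 - ‖s z₀‖) ^ 2 by ring]

end Candidates

end RiemannMapping


/-- **Riemann mapping theorem.** A nonempty, simply connected, open subset of `ℂ`
which is not all of `ℂ` is biholomorphic to the open unit disk: there are holomorphic
maps `f : U → 𝔻` and `g : 𝔻 → U` that are mutually inverse bijections. -/
theorem riemann_mapping_theorem (U : Set ℂ) (hne : U.Nonempty) (hopen : IsOpen U)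
    (hsc : SimplyConnectedSpace U) (hproper : U ≠ Set.univ) :
    ∃ f g : ℂ → ℂ,
      DifferentiableOn ℂ f U ∧
      DifferentiableOn ℂ g (Metric.ball (0 : ℂ) 1) ∧
      Set.MapsTo f U (Metric.ball (0 : ℂ) 1) ∧
      Set.MapsTo g (Metric.ball (0 : ℂ) 1) U ∧
      (∀ z ∈ U, g (f z) = z) ∧
      (∀ w ∈ Metric.ball (0 : ℂ) 1, f (g w) = w) := by
  obtain ⟨z₀, hz₀⟩ := hne
  obtain ⟨f, hf, hd, hmax⟩ :=
    RiemannMapping.exists_isCandidate_maximal hopen hsc hproper hz₀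
  have hmaps := hf.mapsTo_ball hopen
  have himage : f '' U = Metric.ball 0 1 := by
    refine hmaps.image_subset.antisymm fun w hw ↦ ?_
    by_contra hwf
    obtain ⟨g, hg, hlt⟩ := hf.exists_norm_deriv_lt hopen hsc hz₀ hd hw hwf
    exact (hmax g hg).not_gt hlt
  have hsurj : Set.SurjOn f U (Metric.ball 0 1) := himage.ge
  have hleft : ∀ z ∈ U, Function.invFunOn f U (f z) = z := hf.injOn.leftInvOn_invFunOn
  refine ⟨f, Function.invFunOn f U, hf.differentiableOn, ?_, hmaps, hsurj.mapsTo_invFunOn, hleft,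
    hsurj.rightInvOn_invFunOn⟩
  rw [← himage]
  exact RiemannMapping.differentiableOn_leftInverse_of_injOn hopen hf.differentiableOn hf.injOn
    hleft
end

section
/- Let n ≥ 2. There exists an open subset U ⊊ ℂⁿ, strictly contained in ℂⁿ, together with a bijection f : ℂⁿ → U such that f is holomorphic on ℂⁿ and f⁻¹ is holomorphic on U. (Existence of Fatou–Bieberbach domains, cited in Section 1.2(d): proper open subsets of ℂⁿ biholomorphic to ℂⁿ.) -/
open Function Set Metric Topology

/-- A map that semiconjugates `A` to `B` on a forward invariant set `S` extends to the basin
`⋃ k, A^[k] ⁻¹' S`, provided `B` has a left inverse. -/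
theorem exists_semiconj_extension {X Y : Type*} {A : X → X} {B B' : Y → Y}
    (hB : LeftInverse B' B) {S : Set X} (hS : MapsTo A S S) {φ : X → Y}
    (hφ : ∀ x ∈ S, φ (A x) = B (φ x)) :
    ∃ Φ : X → Y, ∀ k x, A^[k] x ∈ S → Φ x = B'^[k] (φ (A^[k] x)) := by
  classical
  refine ⟨fun x => if h : ∃ k, A^[k] x ∈ S then B'^[Nat.find h] (φ (A^[Nat.find h] x)) else φ x,
    fun k x hk => ?_⟩
  have key : ∀ d : ℕ, ∀ z ∈ S, B'^[d] (φ (A^[d] z)) = φ z := by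
    intro d
    induction d with
    | zero => simp
    | succ d ih =>
      intro z hz
      rw [iterate_succ_apply, iterate_succ_apply', hφ _ (hS.iterate d hz), hB, ih z hz]
  have h : ∃ k, A^[k] x ∈ S := ⟨k, hk⟩
  obtain ⟨d, hd⟩ := Nat.exists_eq_add_of_le (Nat.find_min' h hk)
  dsimp only
  rw [dif_pos h, ← key d _ (Nat.find_spec h), ← iterate_add_apply, ← iterate_add_apply,
    add_comm d, ← hd]

section Linearization

variable {E : Type*} [NormedAddCommGroup E] [NormedSpace ℂ E]

/-- The extension of a differentiable semiconjugacy to the basin is differentiable. -/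
theorem differentiableOn_semiconj_extension {A B' : E → E} (hA : Differentiable ℂ A)
    (hB' : Differentiable ℂ B') {S : Set E} (hS : IsOpen S) {φ Φ : E → E}
    (hφ : DifferentiableOn ℂ φ S)
    (hΦ : ∀ k x, A^[k] x ∈ S → Φ x = B'^[k] (φ (A^[k] x))) :
    DifferentiableOn ℂ Φ {x | ∃ k, A^[k] x ∈ S} := by
  rintro x ⟨k, hk⟩
  have hS' : ∀ᶠ y in 𝓝 x, A^[k] y ∈ S :=
    (hA.iterate k).continuous.continuousAt.eventually_mem (hS.mem_nhds hk)
  have hd : DifferentiableAt ℂ (fun y => B'^[k] (φ (A^[k] y))) x :=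
    (hB'.iterate k _).comp x
      ((hφ.differentiableAt (hS.mem_nhds hk)).comp x (hA.iterate k x))
  exact (hd.congr_of_eventuallyEq (hS'.mono fun y hy => hΦ k y hy)).differentiableWithinAt

/-- If a conjugacy between `A` and `B` on open forward invariant sets is given, it
extends to a biholomorphism between the basins. -/
theorem exists_biholomorphic_extension {A B : E ≃ E} (hA : Differentiable ℂ A)
    (hA' : Differentiable ℂ A.symm) (hB : Differentiable ℂ B) (hB' : Differentiable ℂ B.symm)
    {S T : Set E} (hS : IsOpen S) (hT : IsOpen T) (hAS : MapsTo A S S)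
    {φ ψ : E → E} (hφ : DifferentiableOn ℂ φ S) (hψ : DifferentiableOn ℂ ψ T)
    (hST : MapsTo φ S T) (hTS : MapsTo ψ T S) (hl : LeftInvOn ψ φ S) (hr : LeftInvOn φ ψ T)
    (hconj : ∀ x ∈ S, φ (A x) = B (φ x)) :
    ∃ Φ Ψ : E → E, DifferentiableOn ℂ Φ {x | ∃ k, A^[k] x ∈ S} ∧
      DifferentiableOn ℂ Ψ {y | ∃ k, B^[k] y ∈ T} ∧
      MapsTo Φ {x | ∃ k, A^[k] x ∈ S} {y | ∃ k, B^[k] y ∈ T} ∧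
      MapsTo Ψ {y | ∃ k, B^[k] y ∈ T} {x | ∃ k, A^[k] x ∈ S} ∧
      LeftInvOn Ψ Φ {x | ∃ k, A^[k] x ∈ S} ∧ LeftInvOn Φ Ψ {y | ∃ k, B^[k] y ∈ T} := by
  have hconj' : ∀ y ∈ T, ψ (B y) = A (ψ y) := fun y hy => by
    rw [← hl (hAS (hTS hy)), hconj _ (hTS hy), hr hy]
  have hBT : MapsTo B T T := fun y hy => by
    rw [← hr hy, ← hconj _ (hTS hy)]
    exact hST (hAS (hTS hy))
  obtain ⟨Φ, hΦ⟩ := exists_semiconj_extension B.left_inv hAS hconj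
  obtain ⟨Ψ, hΨ⟩ := exists_semiconj_extension A.left_inv hBT hconj'
  have hΦk : ∀ k x, A^[k] x ∈ S → B^[k] (Φ x) = φ (A^[k] x) := fun k x hx => by
    rw [hΦ k x hx]; exact B.right_inv.iterate k _
  have hΨk : ∀ k y, B^[k] y ∈ T → A^[k] (Ψ y) = ψ (B^[k] y) := fun k y hy => by
    rw [hΨ k y hy]; exact A.right_inv.iterate k _
  refine ⟨Φ, Ψ, differentiableOn_semiconj_extension hA hB' hS hφ hΦ,
    differentiableOn_semiconj_extension hB hA' hT hψ hΨ, ?_, ?_, ?_, ?_⟩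
  · rintro x ⟨k, hk⟩
    exact ⟨k, by rw [hΦk k x hk]; exact hST hk⟩
  · rintro y ⟨k, hk⟩
    exact ⟨k, by rw [hΨk k y hk]; exact hTS hk⟩
  · rintro x ⟨k, hk⟩
    rw [hΨ k (Φ x) (by rw [hΦk k x hk]; exact hST hk), hΦk k x hk, hl hk]
    exact A.left_inv.iterate k x
  · rintro y ⟨k, hk⟩
    rw [hΦ k (Ψ y) (by rw [hΨk k y hk]; exact hTS hk), hΨk k y hk, hr hk]
    exact B.left_inv.iterate k y

/-- A map with derivative within `1 / 2` of the identity on a ball is a biholomorphism from that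
ball onto an open set. -/
theorem exists_holomorphic_inverse_on_ball [CompleteSpace E] {h : E → E} {h' : E → E →L[ℂ] E}
    {r : ℝ} (hh : ∀ x ∈ ball (0 : E) r, HasFDerivAt h (h' x) x)
    (hh' : ∀ x ∈ ball (0 : E) r, ‖h' x - ContinuousLinearMap.id ℂ E‖ ≤ 1 / 2) :
    ∃ g : E → E, IsOpen (h '' ball 0 r) ∧ DifferentiableOn ℂ g (h '' ball 0 r) ∧
      MapsTo g (h '' ball 0 r) (ball 0 r) ∧ LeftInvOn g h (ball 0 r) ∧
      LeftInvOn h g (h '' ball 0 r) := by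
  have happrox : ApproximatesLinearOn h
      ((ContinuousLinearEquiv.refl ℂ E : E ≃L[ℂ] E) : E →L[ℂ] E) (ball 0 r) (1 / 2) := by
    intro x hx y hy
    have := (convex_ball (0 : E) r).norm_image_sub_le_of_norm_hasFDerivWithin_le'
      (fun x hx => (hh x hx).hasFDerivWithinAt) hh' hy hx
    simpa using this
  have hc : Subsingleton E ∨ (1 / 2 : NNReal) <
      ‖((ContinuousLinearEquiv.refl ℂ E).symm : E →L[ℂ] E)‖₊⁻¹ := by
    rcases subsingleton_or_nontrivial E with hE | hE
    · exact Or.inl hE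
    · right
      have : ‖((ContinuousLinearEquiv.refl ℂ E).symm : E →L[ℂ] E)‖₊ = 1 :=
        NNReal.eq ContinuousLinearMap.norm_id
      rw [this, inv_one]
      exact NNReal.half_lt_self one_ne_zero
  let e := happrox.toOpenPartialHomeomorph h _ hc isOpen_ball
  refine ⟨e.symm, e.open_target, ?_, fun y hy => e.map_target hy, fun x hx => e.left_inv hx,
    fun y hy => e.right_inv hy⟩
  intro y hy
  have hx : e.symm y ∈ ball (0 : E) r := e.map_target hy
  have hlt : ‖1 - h' (e.symm y)‖ < 1 := by
    rw [norm_sub_rev]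
    exact (hh' _ hx).trans_lt (by norm_num)
  let u := ContinuousLinearEquiv.ofUnit (Units.oneSub (1 - h' (e.symm y)) hlt)
  have hu : (u : E →L[ℂ] E) = h' (e.symm y) := by
    ext z
    change (1 - (1 - h' (e.symm y))) z = _
    simp
  refine (e.hasFDerivAt_symm (f' := u) hy ?_).differentiableAt.differentiableWithinAt
  rw [hu]
  exact hh _ hx

/-- Near a fixed point with derivative `1 / 8`, a `C²` map is conjugate to its linear part. -/
theorem exists_linearization_on_ball [CompleteSpace E] {F : E → E} (hF : ContDiff ℂ 2 F)
    (h0 : F 0 = 0) (hd : fderiv ℂ F 0 = (8 : ℂ)⁻¹ • ContinuousLinearMap.id ℂ E) :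
    ∃ r > 0, ∃ (h : E → E) (h' : E → E →L[ℂ] E),
      (∀ x ∈ ball (0 : E) r, ‖F x‖ ≤ 1 / 4 * ‖x‖) ∧
      (∀ x ∈ ball (0 : E) r, HasFDerivAt h (h' x) x) ∧
      (∀ x ∈ ball (0 : E) r, ‖h' x - ContinuousLinearMap.id ℂ E‖ ≤ 1 / 2) ∧
      h 0 = 0 ∧ ∀ x ∈ ball (0 : E) r, h (F x) = (8 : ℂ)⁻¹ • h x := by
  have hFd : Differentiable ℂ F := hF.differentiable (by norm_num)
  let D : E → E →L[ℂ] E := fun x => fderiv ℂ F x - (8 : ℂ)⁻¹ • ContinuousLinearMap.id ℂ E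
  obtain ⟨C, t, ht, hC⟩ :=
    (hF.fderiv_right (m := 1) (by norm_num)).contDiffAt (x := (0 : E)).exists_lipschitzOnWith
  obtain ⟨r₀, hr₀, hr₀t⟩ := Metric.mem_nhds_iff.1 ht
  obtain ⟨r, hr, hrr₀, hCr⟩ : ∃ r : ℝ, 0 < r ∧ r ≤ r₀ ∧ C * r ≤ 1 / 32 := by
    have hC0 : (0 : ℝ) ≤ C := C.2
    refine ⟨min r₀ (1 / (32 * (C + 1))), by positivity, min_le_left _ _, ?_⟩
    calc (C : ℝ) * min r₀ (1 / (32 * (C + 1))) ≤ C * (1 / (32 * (C + 1))) := by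
          gcongr; exact min_le_right _ _
      _ ≤ 1 / 32 := by
          rw [mul_one_div, div_le_div_iff₀ (by positivity) (by norm_num)]; linarith
  have hD : ∀ x ∈ ball (0 : E) r, ‖D x‖ ≤ C * ‖x‖ := fun x hx => by
    have := hC.norm_sub_le (hr₀t (ball_subset_ball hrr₀ hx)) (hr₀t (mem_ball_self hr₀))
    rwa [hd, sub_zero] at this
  have hF' : ∀ x ∈ ball (0 : E) r, ‖fderiv ℂ F x‖ ≤ 1 / 4 := fun x hx => by
    have hx' : ‖x‖ ≤ r := (mem_ball_zero_iff.1 hx).le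
    have h8 : ‖(8 : ℂ)⁻¹ • ContinuousLinearMap.id ℂ E‖ ≤ 1 / 8 := by
      rw [norm_smul]
      have : ‖(8 : ℂ)⁻¹‖ = 1 / 8 := by norm_num
      rw [this]
      exact mul_le_of_le_one_right (by norm_num) ContinuousLinearMap.norm_id_le
    calc ‖fderiv ℂ F x‖ = ‖D x + (8 : ℂ)⁻¹ • ContinuousLinearMap.id ℂ E‖ := by simp [D]
      _ ≤ C * r + 1 / 8 := (norm_add_le _ _).trans (by
          gcongr; exact (hD x hx).trans (by gcongr))
      _ ≤ 1 / 4 := by linarith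
  have hFle : ∀ x ∈ ball (0 : E) r, ‖F x‖ ≤ 1 / 4 * ‖x‖ := fun x hx => by
    simpa [h0] using (convex_ball (0 : E) r).norm_image_sub_le_of_norm_fderiv_le
      (fun x _ => hFd x) hF' (mem_ball_self hr) hx
  have hFk : ∀ k : ℕ, ∀ x ∈ ball (0 : E) r,
      ‖F^[k] x‖ ≤ (1 / 4) ^ k * ‖x‖ ∧ F^[k] x ∈ ball (0 : E) r ∧
      ‖fderiv ℂ F^[k] x‖ ≤ (1 / 4) ^ k := by
    intro k x hx
    induction k with
    | zero => simpa [mem_ball_zero_iff.1 hx] using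
        ContinuousLinearMap.norm_id_le (𝕜 := ℂ) (E := E)
    | succ k ih =>
      obtain ⟨ih1, ih2, ih3⟩ := ih
      have h1 : ‖F (F^[k] x)‖ ≤ 1 / 4 * ‖F^[k] x‖ := hFle _ ih2
      refine ⟨?_, ?_, ?_⟩
      · rw [iterate_succ_apply', pow_succ']
        linarith
      · rw [iterate_succ_apply', mem_ball_zero_iff]
        have := mem_ball_zero_iff.1 ih2
        linarith [norm_nonneg (F^[k] x)]
      · rw [iterate_succ', fderiv_comp x (hFd _) (hFd.iterate k x), pow_succ']
        exact (ContinuousLinearMap.opNorm_comp_le _ _).trans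
          (mul_le_mul (hF' _ ih2) ih3 (norm_nonneg _) (by norm_num))
  let R : E → E := fun x => F x - (8 : ℂ)⁻¹ • x
  have hR : ∀ x, HasFDerivAt R (D x) x := fun x =>
    (hFd x).hasFDerivAt.sub ((hasFDerivAt_id x).const_smul (8 : ℂ)⁻¹)
  let T : ℕ → E → E := fun k x => (8 : ℂ) ^ (k + 1) • R (F^[k] x)
  let T' : ℕ → E → E →L[ℂ] E := fun k x =>
    (8 : ℂ) ^ (k + 1) • (D (F^[k] x)).comp (fderiv ℂ F^[k] x)
  have hT : ∀ k x, x ∈ ball (0 : E) r → HasFDerivAt (T k) (T' k x) x := fun k x _ =>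
    ((hR _).comp x (hFd.iterate k x).hasFDerivAt).const_smul _
  have hT' : ∀ k x, x ∈ ball (0 : E) r → ‖T' k x‖ ≤ 1 / 4 * (1 / 2) ^ k := by
    intro k x hx
    obtain ⟨h1, h2, h3⟩ := hFk k x hx
    have hx' : ‖x‖ ≤ r := (mem_ball_zero_iff.1 hx).le
    have h4 : ‖D (F^[k] x)‖ ≤ (1 / 4) ^ k * (1 / 32) := calc
      _ ≤ C * ‖F^[k] x‖ := hD _ h2
      _ ≤ C * ((1 / 4) ^ k * r) := by gcongr; exact h1.trans (by gcongr)
      _ = (1 / 4) ^ k * (C * r) := by ring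
      _ ≤ _ := by gcongr
    calc ‖T' k x‖ = 8 ^ (k + 1) * ‖(D (F^[k] x)).comp (fderiv ℂ F^[k] x)‖ := by
          simp [T', norm_smul]
      _ ≤ 8 ^ (k + 1) * ((1 / 4) ^ k * (1 / 32) * (1 / 4) ^ k) := by
          gcongr
          exact (ContinuousLinearMap.opNorm_comp_le _ _).trans (by gcongr)
      _ = 1 / 4 * (8 * (1 / 4) * (1 / 4)) ^ k := by rw [mul_pow, mul_pow]; ring
      _ = 1 / 4 * (1 / 2) ^ k := by norm_num
  have hsum : HasSum (fun k : ℕ => 1 / 4 * (1 / 2 : ℝ) ^ k) (1 / 2) := by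
    have := hasSum_geometric_two.mul_left (1 / 4 : ℝ)
    rwa [show (1 / 4 * 2 : ℝ) = 1 / 2 by norm_num] at this
  have hT0 : ∀ k, T k 0 = 0 := fun k => by
    simp [T, R, iterate_fixed h0 k, h0]
  have hball : IsPreconnected (ball (0 : E) r) := (convex_ball (0 : E) r).isPreconnected
  have hTs : ∀ x ∈ ball (0 : E) r, Summable fun k => T k x := fun x hx =>
    summable_of_summable_hasFDerivAt_of_isPreconnected hsum.summable isOpen_ball hball hT hT'
      (mem_ball_self hr) (by simp [hT0]) hx
  refine ⟨r, hr, fun x => x + ∑' k, T k x,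
    fun x => ContinuousLinearMap.id ℂ E + ∑' k, T' k x, hFle, fun x hx => ?_, fun x hx => ?_,
    by simp [hT0], fun x hx => ?_⟩
  · exact (hasFDerivAt_id x).add
      (hasFDerivAt_tsum_of_isPreconnected hsum.summable isOpen_ball hball hT hT'
        (mem_ball_self hr) (by simp [hT0]) hx)
  · rw [add_sub_cancel_left]
    exact tsum_of_norm_bounded hsum fun k => hT' k x hx
  · have hshift : ∀ k, T k (F x) = (8 : ℂ)⁻¹ • T (k + 1) x := fun k => by
      simp only [T, iterate_succ_apply, smul_smul]
      congr 1
      rw [pow_succ (8 : ℂ) (k + 1)]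
      field_simp
    have htsum : ∑' k, T k x = (8 : ℂ) • R x + ∑' k, T (k + 1) x := by
      rw [(hTs x hx).tsum_eq_zero_add]
      simp [T]
    simp only [hshift, htsum, tsum_const_smul'', smul_add, smul_smul, R]
    norm_num
    abel

/-- The basin of a fixed point at which the derivative of an automorphism is `1 / 8`
is biholomorphic to the whole space. -/
theorem exists_biholomorphism_onto_basin [CompleteSpace E] (F : E ≃ E) (hF : ContDiff ℂ 2 F)
    (hF' : Differentiable ℂ F.symm) (h0 : F 0 = 0)
    (hd : fderiv ℂ F 0 = (8 : ℂ)⁻¹ • ContinuousLinearMap.id ℂ E) :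
    ∃ U : Set E, IsOpen U ∧ (∀ x ∈ U, F x = x → x = 0) ∧
      ∃ f g : E → E, Differentiable ℂ f ∧ range f = U ∧ DifferentiableOn ℂ g U ∧
        (∀ z, g (f z) = z) ∧ ∀ w ∈ U, f (g w) = w := by
  have hFd : Differentiable ℂ F := hF.differentiable (by norm_num)
  obtain ⟨r, hr, h, h', hle, hder, hder', hh0, hconj⟩ := exists_linearization_on_ball hF h0 hd
  obtain ⟨g, hVo, hg, hgm, hl, hrr⟩ := exists_holomorphic_inverse_on_ball hder hder'
  have hmaps : MapsTo F (ball 0 r) (ball 0 r) := fun x hx => by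
    have := hle x hx
    rw [mem_ball_zero_iff] at hx ⊢
    linarith [norm_nonneg x]
  let L : E ≃L[ℂ] E := ContinuousLinearEquiv.smulLeft (Units.mk0 (8 : ℂ)⁻¹ (by norm_num))
  let B : E ≃ E := L.toEquiv
  have hB : ∀ x, B x = (8 : ℂ)⁻¹ • x := fun x => rfl
  obtain ⟨Φ, Ψ, hΦ, hΨ, hΦm, hΨm, hΨΦ, hΦΨ⟩ := exists_biholomorphic_extension (A := F) (B := B)
    hFd hF' L.differentiable L.symm.differentiable
    isOpen_ball hVo hmaps (fun x hx => (hder x hx).differentiableAt.differentiableWithinAt) hg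
    (mapsTo_image _ _) hgm hl hrr (fun x hx => by rw [hconj x hx, hB])
  have huniv : {y | ∃ k, B^[k] y ∈ h '' ball 0 r} = univ := by
    refine eq_univ_of_forall fun y => ?_
    have hBk : ∀ k, B^[k] y = ((8 : ℂ)⁻¹) ^ k • y := fun k => by
      induction k with
      | zero => simp
      | succ k ih => rw [iterate_succ_apply', ih, hB, smul_smul, pow_succ']
    have hlim : Filter.Tendsto (fun k => B^[k] y) Filter.atTop (𝓝 0) := by
      simp only [hBk]
      simpa using (tendsto_pow_atTop_nhds_zero_of_norm_lt_one
        (show ‖(8 : ℂ)⁻¹‖ < 1 by norm_num)).smul_const y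
    exact (hlim.eventually_mem (hVo.mem_nhds ⟨0, mem_ball_self hr, hh0⟩)).exists
  rw [huniv] at hΨ hΦm hΨm hΦΨ
  refine ⟨{x | ∃ k, F^[k] x ∈ ball 0 r}, ?_, ?_, Ψ, Φ, differentiableOn_univ.1 hΨ, ?_, hΦ,
    fun z => hΦΨ (mem_univ z), fun w hw => hΨΦ hw⟩
  · rw [ofPred_exists]
    exact isOpen_iUnion fun k => isOpen_ball.preimage (hFd.iterate k).continuous
  · rintro x ⟨k, hk⟩ hx
    rw [iterate_fixed hx] at hk
    have := hle x hk
    rw [hx] at this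
    exact norm_le_zero_iff.1 (by linarith)
  · exact Subset.antisymm (range_subset_iff.2 fun y => hΨm (mem_univ y))
      fun x hx => ⟨Φ x, hΨΦ hx⟩

/-- The shear `x ↦ x + (φ x)² v` along a vector `v` in the kernel of `φ`. -/
noncomputable def quadraticShear (φ : E →L[ℂ] ℂ) (v : E) (hv : φ v = 0) : E ≃ E where
  toFun x := x + (φ x) ^ 2 • v
  invFun x := x - (φ x) ^ 2 • v
  left_inv x := by simp [hv]
  right_inv x := by simp [hv]

/-- Fatou–Bieberbach domains exist in every complex Banach space that carries two independent
continuous linear functionals. -/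
theorem exists_fatou_bieberbach_domain_of_dual_pair [CompleteSpace E] {a b : E} {α β : E →L[ℂ] ℂ}
    (hαa : α a = 1) (hαb : α b = 0) (hβa : β a = 0) (hβb : β b = 1) :
    ∃ U : Set E, IsOpen U ∧ U ≠ univ ∧
      ∃ f g : E → E, Differentiable ℂ f ∧ range f = U ∧ DifferentiableOn ℂ g U ∧
        (∀ z, g (f z) = z) ∧ ∀ w ∈ U, f (g w) = w := by
  let F : E ≃ E :=
    ((quadraticShear β a hβa).trans (quadraticShear α b hαb)).trans
      (ContinuousLinearEquiv.smulLeft (R₁ := ℂ) (M₁ := E)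
        (Units.mk0 (8 : ℂ)⁻¹ (by norm_num))).toEquiv
  have hF : (F : E → E) = fun x =>
      (8 : ℂ)⁻¹ • (x + (β x) ^ 2 • a + (α (x + (β x) ^ 2 • a)) ^ 2 • b) := rfl
  have hFs : (F.symm : E → E) = fun x =>
      (8 : ℂ) • x - (α ((8 : ℂ) • x)) ^ 2 • b
        - (β ((8 : ℂ) • x - (α ((8 : ℂ) • x)) ^ 2 • b)) ^ 2 • a := by
    funext x
    rw [Equiv.symm_apply_eq, hF]
    simp [hαb, hβa, hβb]
  have hd : HasFDerivAt F
      ((8 : ℂ)⁻¹ • ContinuousLinearMap.id ℂ E) 0 := by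
    have h1 : HasFDerivAt (fun x => x + (β x) ^ 2 • a) (ContinuousLinearMap.id ℂ E) 0 :=
      ((hasFDerivAt_id (0 : E)).add ((β.hasFDerivAt.pow 2).smul_const a)).congr_fderiv
        (by ext; simp)
    rw [hF]
    exact ((h1.add (((α.hasFDerivAt.comp _ h1).pow 2).smul_const b)).const_smul
      (8 : ℂ)⁻¹).congr_fderiv (by ext; simp)
  obtain ⟨U, hU, hfix, f, g, hf, hfU, hg, hgf, hfg⟩ := exists_biholomorphism_onto_basin F
    (by rw [hF]; fun_prop) (by rw [hFs]; fun_prop) (by simp [hF]) hd.fderiv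
  refine ⟨U, hU, ?_, f, g, hf, hfU, hg, hgf, hfg⟩
  rintro rfl
  let p := (7 / 16 : ℂ) • a + (7 / 4 : ℂ) • b
  have hp : F p = p := by
    rw [hF]
    simp only [p, map_add, map_smul, hαa, hαb, hβa, hβb, smul_eq_mul]
    module
  have hp0 := congrArg α (hfix p (mem_univ p) hp)
  simp [p, hαa, hαb] at hp0

end Linearization

/-- **Existence of Fatou–Bieberbach domains.** For `n ≥ 2` there exists an open set
`U ⊊ ℂⁿ`, strictly contained in `ℂⁿ`, and a biholomorphism `f : ℂⁿ → U`: a holomorphic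
bijection from `ℂⁿ` onto `U` whose inverse is holomorphic on `U`. -/
theorem exists_fatou_bieberbach_domain (n : ℕ) (hn : 2 ≤ n) :
    ∃ U : Set (EuclideanSpace ℂ (Fin n)),
      IsOpen U ∧ U ≠ Set.univ ∧
      ∃ f g : EuclideanSpace ℂ (Fin n) → EuclideanSpace ℂ (Fin n),
        Differentiable ℂ f ∧
        Set.range f = U ∧
        DifferentiableOn ℂ g U ∧
        (∀ z, g (f z) = z) ∧
        (∀ w ∈ U, f (g w) = w) := by
  let i : Fin n := ⟨0, by omega⟩
  let j : Fin n := ⟨1, by omega⟩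
  have hij : i ≠ j := by simp [i, j]
  exact exists_fatou_bieberbach_domain_of_dual_pair
    (a := EuclideanSpace.single i 1) (b := EuclideanSpace.single j 1)
    (α := EuclideanSpace.proj i) (β := EuclideanSpace.proj j)
    (by simp) (by simp [hij]) (by simp [hij.symm]) (by simp)
end
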